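/- Let (R, m) be a commutative Noetherian local ring, I an ideal, T an R-module, and U, V, W, Z finitely generated submodules of T with Z ⊆ U and W ⊆ V. Set L_n := (U + I^n V)/(Z + I^n W), assume L_n has finite length for all sufficiently large n, and let J be an ideal of R with J ⊆ ann_R((V + Z)/Z). Then the polynomial p with rational coefficients satisfying λ(L_n) = p(n) for all sufficiently large n has deg p ≤ max{dim U/Z, ℓ_{R/J}(I) − 1}. -/

import Mathlib

/-- The length `λ(M)` of a module `M`, realized as the Krull dimension of the lattice of
submodules of `M`. -/
noncomputable def moduleLength (R M : Type*) [Ring R] [AddCommGroup M] [Module R M] :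
    WithBot ℕ∞ :=
  Order.krullDim (Submodule R M)

/-- The analytic spread of the ideal `I` relative to the ideal `m`: the Krull dimension of
the special fiber ring `⊕ₙ Iⁿ/(m Iⁿ)`, realized as the quotient of the Rees algebra
`R[It] = ⊕ₙ Iⁿ` by the extension of `m`. -/
noncomputable def analyticSpread {R : Type*} [CommRing R] (I m : Ideal R) : WithBot ℕ∞ :=
  ringKrullDim ((reesAlgebra I) ⧸ (Ideal.map (algebraMap R (reesAlgebra I)) m))

/-- The degree of a polynomial, viewed in `WithBot ℕ∞` so that it can be compared with
Krull dimensions. -/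
noncomputable def polyDeg (p : Polynomial ℚ) : WithBot ℕ∞ :=
  p.degree.map (Nat.cast : ℕ → ℕ∞)

section RelLength

variable {R T T' : Type*} [CommRing R] [AddCommGroup T] [Module R T] [AddCommGroup T'] [Module R T']

/-- The length of `A / (A ⊓ B)`, realized as the image of `A` in `T ⧸ B`. -/
noncomputable def relLength (A B : Submodule R T) : ℕ∞ :=
  Module.length R ↥(A.map B.mkQ)

lemma length_le_of_le {A B : Submodule R T} (h : A ≤ B) :
    Module.length R A ≤ Module.length R B :=
  Module.length_le_of_injective (Submodule.inclusion h) (Submodule.inclusion_injective h)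

lemma length_map_le (f : T →ₗ[R] T') (A : Submodule R T) :
    Module.length R ↥(A.map f) ≤ Module.length R A :=
  Module.length_le_of_surjective (f.submoduleMap A) (f.submoduleMap_surjective A)

lemma length_map_eq_of_injective (f : T →ₗ[R] T') (hf : Function.Injective f)
    (A : Submodule R T) : Module.length R ↥(A.map f) = Module.length R A :=
  (Submodule.equivMapOfInjective f hf A).length_eq.symm

lemma length_sup_le (A B : Submodule R T) :
    Module.length R ↥(A ⊔ B) ≤ Module.length R A + Module.length R B := by
  rw [← Module.length_prod]
  have h : LinearMap.range (A.subtype.coprod B.subtype) = A ⊔ B := by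
    rw [LinearMap.range_coprod, Submodule.range_subtype, Submodule.range_subtype]
  rw [← h]
  exact Module.length_le_of_surjective _ (LinearMap.surjective_rangeRestrict _)

lemma relLength_mono_left {A A' : Submodule R T} (h : A ≤ A') (B : Submodule R T) :
    relLength A B ≤ relLength A' B :=
  length_le_of_le (Submodule.map_mono h)

lemma relLength_map_le (f : T →ₗ[R] T') {A B : Submodule R T} {B' : Submodule R T'}
    (h : B.map f ≤ B') : relLength (A.map f) B' ≤ relLength A B := by
  have h' : B ≤ B'.comap f := Submodule.map_le_iff_le_comap.mp h
  have : (A.map f).map B'.mkQ = (A.map B.mkQ).map (B.mapQ B' f h') := by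
    rw [← Submodule.map_comp, ← Submodule.map_comp, Submodule.mapQ_mkQ]
  rw [relLength, this]
  exact length_map_le _ _

lemma relLength_anti_right (A : Submodule R T) {B B' : Submodule R T} (h : B ≤ B') :
    relLength A B' ≤ relLength A B := by
  simpa using relLength_map_le (A := A) (B := B) (B' := B') LinearMap.id (by simpa using h)

lemma relLength_map_of_ker_le (f : T →ₗ[R] T') {A B : Submodule R T} (h : LinearMap.ker f ≤ B) :
    relLength (A.map f) (B.map f) = relLength A B := by
  have h' : B = (B.map f).comap f := by rw [Submodule.comap_map_eq, sup_eq_left.mpr h]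
  have : (A.map f).map (B.map f).mkQ = (A.map B.mkQ).map (B.mapQ (B.map f) f h'.le) := by
    rw [← Submodule.map_comp, ← Submodule.map_comp, Submodule.mapQ_mkQ]
  rw [relLength, this]
  refine length_map_eq_of_injective _ ?_ _
  rw [← LinearMap.ker_eq_bot, Submodule.mapQ, Submodule.ker_liftQ, LinearMap.ker_comp,
    Submodule.ker_mkQ, ← h', ← LinearMap.le_ker_iff_map, Submodule.ker_mkQ]

lemma relLength_sup_left_le (A A' B : Submodule R T) :
    relLength (A ⊔ A') B ≤ relLength A B + relLength A' B := by
  rw [relLength, Submodule.map_sup]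
  exact length_sup_le _ _

lemma relLength_eq_zero {A B : Submodule R T} (h : A ≤ B) : relLength A B = 0 := by
  have : A.map B.mkQ = ⊥ := by rwa [← LinearMap.le_ker_iff_map, Submodule.ker_mkQ]
  rw [relLength, this, Module.length_bot]

lemma relLength_sup_left_of_le {A A' B : Submodule R T} (h : A' ≤ B) :
    relLength (A ⊔ A') B = relLength A B := by
  refine le_antisymm ((relLength_sup_left_le _ _ _).trans ?_) (relLength_mono_left le_sup_left _)
  rw [relLength_eq_zero h, add_zero]

lemma relLength_le_add (A B C : Submodule R T) :
    relLength A C ≤ relLength A B + relLength B C := by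
  let g : (T ⧸ C) →ₗ[R] T ⧸ (B ⊔ C) := Submodule.factor le_sup_right
  let f := g.domRestrict (A.map C.mkQ)
  have hr : LinearMap.range f = A.map (B ⊔ C).mkQ := by
    rw [LinearMap.range_domRestrict, ← Submodule.map_comp]
    rfl
  have hk : Module.length R (LinearMap.ker f) ≤ relLength B C := by
    rw [← length_map_eq_of_injective (A.map C.mkQ).subtype (Submodule.subtype_injective _)]
    refine length_le_of_le ?_
    rintro _ ⟨⟨_, a, ha, rfl⟩, hx, rfl⟩
    have hx' : a ∈ B ⊔ C := by simpa [f, g] using hx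
    obtain ⟨b, hb, c, hc, rfl⟩ := Submodule.mem_sup.mp hx'
    exact ⟨b, hb, by simp [hc]⟩
  have he : Function.Exact (LinearMap.ker f).subtype f.rangeRestrict := by
    rw [LinearMap.exact_iff, LinearMap.ker_rangeRestrict, Submodule.range_subtype]
  have : Module.length R ↥(A.map C.mkQ) =
      Module.length R (LinearMap.ker f) + Module.length R (LinearMap.range f) := by
    apply Module.length_eq_add_of_exact (N := LinearMap.ker f) (P := LinearMap.range f)
      (LinearMap.ker f).subtype f.rangeRestrict
    · exact (LinearMap.ker f).subtype_injective
    · exact f.surjective_rangeRestrict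
    · exact he
  rw [relLength, this, add_comm, hr]
  exact add_le_add (relLength_anti_right A le_sup_left) hk

lemma relLength_span_smul_le (s : Finset R) (K : Ideal R) (V : Submodule R T) :
    relLength (Ideal.span (s : Set R) • V) (K • Ideal.span (s : Set R) • V) ≤
      s.card * relLength V (K • V) := by
  suffices h : ∀ t ⊆ s, relLength (Ideal.span (t : Set R) • V)
      (K • Ideal.span (s : Set R) • V) ≤ t.card * relLength V (K • V) from h s subset_rfl
  classical
  intro t
  induction t using Finset.induction_on with
  | empty => intro _; simp [relLength_eq_zero]
  | insert a t ha ih =>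
    intro hs
    rw [Finset.coe_insert, Ideal.span_insert, Submodule.sup_smul, Finset.card_insert_of_notMem ha,
      add_comm, Nat.cast_add, add_mul, Nat.cast_one, one_mul]
    refine (relLength_sup_left_le _ _ _).trans ?_
    rw [add_comm]
    refine (add_le_add (ih ((Finset.subset_insert _ _).trans hs)) ?_).trans_eq (add_comm _ _)
    have hV (W : Submodule R T) : Ideal.span {a} • W = W.map (LinearMap.lsmul R T a) := by
      rw [Submodule.ideal_span_singleton_smul]
      rfl
    rw [hV]
    refine relLength_map_le _ ?_
    rw [← hV, ← mul_smul, mul_comm, mul_smul]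
    refine smul_mono_right _ (Submodule.smul_mono_left (Ideal.span_mono ?_))
    simpa using hs (Finset.mem_insert_self a t)

end RelLength

section Local

variable {R T : Type*} [CommRing R] [IsLocalRing R] [AddCommGroup T] [Module R T]

open IsLocalRing

lemma exists_maximalIdeal_pow_smul_le {A B : Submodule R T} (h : relLength A B ≠ ⊤) :
    ∃ k, maximalIdeal R ^ k • A ≤ B := by
  rw [relLength, Module.length_ne_top_iff, isFiniteLength_iff_isNoetherian_isArtinian] at h
  obtain ⟨_, _⟩ := h
  set M := ↥(A.map B.mkQ)
  obtain ⟨k, hk⟩ := IsArtinian.monotone_stabilizes (R := R) (M := M)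
    ⟨fun n ↦ OrderDual.toDual (maximalIdeal R ^ n • (⊤ : Submodule R M)),
      fun i j e ↦ Submodule.smul_mono_left (Ideal.pow_le_pow_right e)⟩
  have h0 : maximalIdeal R ^ k • (⊤ : Submodule R M) = ⊥ := by
    refine Submodule.eq_bot_of_le_smul_of_le_jacobson_bot (maximalIdeal R) _
      (IsNoetherian.noetherian _) ?_ ?_
    · rw [← mul_smul, ← pow_succ']
      exact (show maximalIdeal R ^ k • (⊤ : Submodule R M) = maximalIdeal R ^ (k + 1) • ⊤ from
        hk (k + 1) k.le_succ).le
    · rw [jacobson_eq_maximalIdeal _ bot_ne_top]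
  refine ⟨k, ?_⟩
  rw [← Submodule.ker_mkQ B, LinearMap.le_ker_iff_map, Submodule.map_smul'', eq_bot_iff]
  have := congrArg (Submodule.map (A.map B.mkQ).subtype) h0
  rw [Submodule.map_smul'', Submodule.map_top, Submodule.range_subtype, Submodule.map_bot] at this
  exact this.le

variable [IsNoetherianRing R]

lemma relLength_maximalIdeal_pow_smul_ne_top {A : Submodule R T} (hA : A.FG) (k : ℕ) :
    relLength A (maximalIdeal R ^ k • A) ≠ ⊤ := by
  obtain ⟨s, rfl⟩ := hA
  have hk : relLength (⊤ : Submodule R R) (maximalIdeal R ^ k) ≠ ⊤ := by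
    have : IsArtinianRing (R ⧸ maximalIdeal R ^ (k + 1)) :=
      quotient_artinian_of_mem_minimalPrimes_of_isLocalRing _
        ⟨⟨inferInstance, Ideal.pow_le_self (Nat.succ_ne_zero k)⟩,
          fun q hq _ ↦ hq.1.le_of_pow_le hq.2⟩
    refine ne_top_of_le_ne_top ?_ (relLength_anti_right ⊤ (Ideal.pow_le_pow_right k.le_succ))
    rw [relLength, Submodule.map_top, Submodule.range_mkQ, Module.length_top]
    have := Module.length_ne_top (R := R ⧸ maximalIdeal R ^ (k + 1))
      (M := R ⧸ maximalIdeal R ^ (k + 1))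
    rwa [← Module.length_eq_of_surjective (S := R) Ideal.Quotient.mk_surjective] at this
  suffices h : ∀ t ⊆ s, relLength (Submodule.span R (t : Set T))
      (maximalIdeal R ^ k • Submodule.span R (s : Set T)) ≠ ⊤ from h s subset_rfl
  classical
  intro t
  induction t using Finset.induction_on with
  | empty => intro _; simp [relLength_eq_zero]
  | insert a t ha ih =>
    intro hs
    rw [Finset.coe_insert, Submodule.span_insert]
    refine ne_top_of_le_ne_top ?_ (relLength_sup_left_le _ _ _)
    refine WithTop.add_ne_top.mpr ⟨?_, ih ((Finset.subset_insert _ _).trans hs)⟩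
    have h1 : Submodule.span R {a} = (⊤ : Submodule R R).map (LinearMap.toSpanSingleton R T a) := by
      rw [Submodule.map_top, LinearMap.range_toSpanSingleton]
    rw [h1]
    refine ne_top_of_le_ne_top hk (relLength_map_le _ ?_)
    rintro _ ⟨r, hr, rfl⟩
    exact Submodule.smul_mem_smul hr (Submodule.subset_span (hs (Finset.mem_insert_self a t)))

end Local

section PowBound

variable {R T : Type*} [CommRing R] [AddCommGroup T] [Module R T]

lemma relLength_sup_span_singleton_pow_le (U : Submodule R T) (K : Ideal R) (x : R) (m : ℕ) :
    relLength U ((K ⊔ Ideal.span {x ^ m}) • U) ≤ m * relLength U ((K ⊔ Ideal.span {x}) • U) := by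
  induction m with
  | zero => simp [relLength_eq_zero]
  | succ m ih =>
    refine (relLength_le_add U ((K ⊔ Ideal.span {x ^ m}) • U) _).trans ?_
    rw [Nat.cast_add, add_mul, Nat.cast_one, one_mul]
    refine add_le_add ih ?_
    have hV (y : R) (W : Submodule R T) :
        Ideal.span {y} • W = W.map (LinearMap.lsmul R T y) := by
      rw [Submodule.ideal_span_singleton_smul]
      rfl
    rw [Submodule.sup_smul, sup_comm, relLength_sup_left_of_le
      (Submodule.smul_mono_left le_sup_left), hV]
    refine relLength_map_le _ ?_
    rw [← hV, ← mul_smul, Ideal.mul_sup, Ideal.span_singleton_mul_span_singleton, ← pow_succ]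
    exact Submodule.smul_mono_left (sup_le_sup_right Ideal.mul_le_right _)

lemma relLength_sup_span_image_pow_le (U : Submodule R T) (m : ℕ) (s : Finset R) (K : Ideal R) :
    relLength U ((K ⊔ Ideal.span ((· ^ m) '' (s : Set R))) • U) ≤
      m ^ s.card * relLength U ((K ⊔ Ideal.span (s : Set R)) • U) := by
  classical
  induction s using Finset.induction_on generalizing K with
  | empty => simp
  | insert a t ha ih =>
    rw [Finset.coe_insert, Set.image_insert_eq, Ideal.span_insert, Ideal.span_insert,
      Finset.card_insert_of_notMem ha, ← sup_assoc, ← sup_assoc, pow_succ, mul_assoc]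
    refine (ih _).trans ?_
    gcongr
    have := relLength_sup_span_singleton_pow_le U (K ⊔ Ideal.span (t : Set R)) a m
    rwa [sup_right_comm, sup_right_comm K _ (Ideal.span {a})] at this

variable [IsNoetherianRing R] [IsLocalRing R]

open IsLocalRing

/-- The upper bound in the dimension theorem: the Hilbert–Samuel function of a finitely generated
module grows at most like a polynomial of degree the dimension of the module. -/
lemma exists_relLength_maximalIdeal_pow_smul_le {U : Submodule R T} (hU : U.FG) {d : ℕ}
    (hd : ringKrullDim (R ⧸ Module.annihilator R U) = d) :
    ∃ C : ℕ, ∀ k : ℕ, relLength U (maximalIdeal R ^ k • U) ≤ C * (k + 1) ^ d := by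
  classical
  set a := Module.annihilator R U
  have : Nontrivial (R ⧸ a) := by
    by_contra h
    rw [not_nontrivial_iff_subsingleton] at h
    rw [ringKrullDim_eq_bot_of_subsingleton] at hd
    exact WithBot.bot_ne_coe hd
  have := IsLocalRing.of_surjective' (Ideal.Quotient.mk a) Ideal.Quotient.mk_surjective
  have := IsLocalHom.of_surjective (Ideal.Quotient.mk a) Ideal.Quotient.mk_surjective
  obtain ⟨s, hs, hcard⟩ :=
    Ideal.exists_finset_card_eq_height_of_isNoetherianRing (maximalIdeal (R ⧸ a))
  have hcard : s.card = d := by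
    rw [← maximalIdeal_height_eq_ringKrullDim, ← hcard] at hd
    exact_mod_cast hd
  have : IsArtinianRing ((R ⧸ a) ⧸ Ideal.span (s : Set (R ⧸ a))) :=
    quotient_artinian_of_mem_minimalPrimes_of_isLocalRing _ hs
  obtain ⟨n, hn⟩ := exists_maximalIdeal_pow_le_of_isArtinianRing_quotient
    (Ideal.span (s : Set (R ⧸ a)))
  set t : Finset R := s.image Quotient.out
  have ht : (Ideal.span (t : Set R)).map (Ideal.Quotient.mk a) = Ideal.span (s : Set (R ⧸ a)) := by
    rw [Ideal.map_span, Finset.coe_image, ← Set.image_comp]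
    congr 1
    have : (Ideal.Quotient.mk a : R → R ⧸ a) ∘ Quotient.out = id :=
      funext fun x ↦ Quotient.out_eq x
    rw [this, Set.image_id]
  have hmap : (maximalIdeal R).map (Ideal.Quotient.mk a) ≤ maximalIdeal (R ⧸ a) := by
    rw [Ideal.map_le_iff_le_comap]
    intro x hx
    simpa using hx
  have htm : ∀ x ∈ t, x ∈ maximalIdeal R := by
    intro x hx
    have : Ideal.Quotient.mk a x ∈ maximalIdeal (R ⧸ a) :=
      hs.1.2 (ht ▸ Ideal.mem_map_of_mem _ (Ideal.subset_span hx))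
    simpa using this
  have hn' : maximalIdeal R ^ n • U ≤ Ideal.span (t : Set R) • U := by
    have h1 : maximalIdeal R ^ n ≤ Ideal.span (t : Set R) ⊔ a := by
      have := (Ideal.pow_right_mono hmap n).trans hn
      rw [← ht, ← Ideal.map_pow, Ideal.map_le_iff_le_comap,
        Ideal.comap_map_of_surjective _ Ideal.Quotient.mk_surjective] at this
      simpa [← RingHom.ker_eq_comap_bot] using this
    refine (Submodule.smul_mono_left h1).trans ?_
    rw [Submodule.sup_smul]
    refine sup_le le_rfl ((Submodule.smul_le.mpr fun r hr u hu ↦ ?_).trans bot_le)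
    exact congrArg Subtype.val (Module.mem_annihilator.mp hr ⟨u, hu⟩)
  have hfin : relLength U (Ideal.span (t : Set R) • U) ≠ ⊤ :=
    ne_top_of_le_ne_top (relLength_maximalIdeal_pow_smul_ne_top hU n)
      (relLength_anti_right U hn')
  obtain ⟨C, hC⟩ := ENat.ne_top_iff_exists.mp hfin
  refine ⟨C, fun k ↦ ?_⟩
  have hle : Ideal.span ((· ^ k) '' (t : Set R)) ≤ maximalIdeal R ^ k := by
    rw [Ideal.span_le]
    rintro _ ⟨x, hx, rfl⟩
    exact Ideal.pow_mem_pow (htm x hx) k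
  refine (relLength_anti_right U (Submodule.smul_mono_left hle)).trans ?_
  have := relLength_sup_span_image_pow_le U k t ⊥
  rw [bot_sup_eq, bot_sup_eq, ← hC] at this
  refine this.trans ?_
  have htd : t.card ≤ d := Finset.card_image_le.trans_eq hcard
  have : k ^ t.card ≤ (k + 1) ^ d :=
    (Nat.pow_le_pow_left k.le_succ _).trans (Nat.pow_le_pow_right k.succ_pos htd)
  rw [mul_comm]
  exact mul_le_mul_right (by exact_mod_cast this) _

end PowBound

section Growth

variable {k F : Type*} [Field k] [CommRing F] [Algebra k F] {s : ℕ}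

open MvPolynomial

/-- The submodule of polynomials whose degree in each variable is at most `m`, times the span of
a finite set `b`. -/
noncomputable def boundedDegreeSpan (g : MvPolynomial (Fin s) k →ₐ[k] F) (b : Finset F) (m : ℕ) :
    Submodule k F :=
  (restrictDegree (Fin s) k m).map g.toLinearMap * Submodule.span k (b : Set F)

lemma mem_restrictDegree_iff_degreeOf (p : MvPolynomial (Fin s) k) (m : ℕ) :
    p ∈ restrictDegree (Fin s) k m ↔ ∀ i, degreeOf i p ≤ m := by
  classical
  rw [mem_restrictDegree_iff_sup]
  simp [degreeOf_def]

lemma restrictDegree_mono {m n : ℕ} (h : m ≤ n) :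
    restrictDegree (Fin s) k m ≤ restrictDegree (Fin s) k n := by
  intro p hp
  rw [mem_restrictDegree_iff_degreeOf] at hp ⊢
  exact fun i ↦ (hp i).trans h

lemma restrictDegree_mul_le (m n : ℕ) :
    restrictDegree (Fin s) k m * restrictDegree (Fin s) k n ≤ restrictDegree (Fin s) k (m + n) := by
  rw [Submodule.mul_le]
  intro p hp q hq
  rw [mem_restrictDegree_iff_degreeOf] at hp hq ⊢
  exact fun i ↦ (degreeOf_mul_le i p q).trans (add_le_add (hp i) (hq i))

lemma exists_mem_restrictDegree (p : MvPolynomial (Fin s) k) :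
    ∃ m, p ∈ restrictDegree (Fin s) k m := by
  refine ⟨Finset.univ.sup fun i ↦ degreeOf i p, ?_⟩
  rw [mem_restrictDegree_iff_degreeOf]
  exact fun i ↦ Finset.le_sup (f := fun i ↦ degreeOf i p) (Finset.mem_univ i)

lemma restrictDegree_le_span (m : ℕ) : restrictDegree (Fin s) k m ≤ Submodule.span k
    (Set.range fun e : Fin s → Fin (m + 1) ↦
      monomial (Finsupp.equivFunOnFinite.symm fun i ↦ (e i : ℕ)) (1 : k)) := by
  intro p hp
  rw [mem_restrictDegree] at hp
  rw [p.as_sum]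
  refine Submodule.sum_mem _ fun e he ↦ ?_
  rw [← mul_one (coeff e p), ← smul_eq_mul, ← smul_monomial]
  refine Submodule.smul_mem _ _ (Submodule.subset_span
    ⟨fun i ↦ ⟨e i, Nat.lt_succ_of_le (hp e he i)⟩, ?_⟩)
  exact congrArg (monomial · 1) (Finsupp.ext fun i ↦ rfl)

lemma boundedDegreeSpan_mono (g : MvPolynomial (Fin s) k →ₐ[k] F) (b : Finset F) {m n : ℕ}
    (h : m ≤ n) : boundedDegreeSpan g b m ≤ boundedDegreeSpan g b n :=
  mul_le_mul_left (Submodule.map_mono (restrictDegree_mono h)) _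

lemma map_restrictDegree_mul_boundedDegreeSpan_le (g : MvPolynomial (Fin s) k →ₐ[k] F)
    (b : Finset F) (m n : ℕ) :
    (restrictDegree (Fin s) k m).map g.toLinearMap * boundedDegreeSpan g b n ≤
      boundedDegreeSpan g b (m + n) := by
  rw [boundedDegreeSpan, ← mul_assoc, ← Submodule.map_mul]
  exact mul_le_mul_left (Submodule.map_mono (restrictDegree_mul_le m n)) _

lemma finrank_boundedDegreeSpan_le (g : MvPolynomial (Fin s) k →ₐ[k] F) (b : Finset F) (m : ℕ) :
    Module.Finite k (boundedDegreeSpan g b m) ∧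
      Module.finrank k (boundedDegreeSpan g b m) ≤ (m + 1) ^ s * b.card := by
  classical
  set v : (Fin s → Fin (m + 1)) × b → F := fun x ↦
    g (monomial (Finsupp.equivFunOnFinite.symm fun i ↦ (x.1 i : ℕ)) 1) * x.2
  have h : boundedDegreeSpan g b m ≤ Submodule.span k (Set.range v) := by
    refine (mul_le_mul_left (Submodule.map_mono (restrictDegree_le_span m)) _).trans ?_
    rw [Submodule.map_span, Submodule.span_mul_span]
    refine Submodule.span_mono ?_
    rintro _ ⟨_, ⟨_, ⟨e, rfl⟩, rfl⟩, y, hy, rfl⟩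
    exact ⟨(e, ⟨y, hy⟩), rfl⟩
  have : Module.Finite k (Submodule.span k (Set.range v)) :=
    FiniteDimensional.span_of_finite k (Set.finite_range v)
  refine ⟨Submodule.finiteDimensional_of_le h, (Submodule.finrank_mono h).trans ?_⟩
  refine (finrank_range_le_card v).trans_eq ?_
  simp

lemma exists_le_boundedDegreeSpan (g : MvPolynomial (Fin s) k →ₐ[k] F) (hg : g.Finite) :
    ∃ b : Finset F, ∀ N : Submodule k F, N.FG → ∃ m, N ≤ boundedDegreeSpan g b m := by
  classical
  algebraize [g.toRingHom]
  have : Module.Finite (MvPolynomial (Fin s) k) F := hg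
  obtain ⟨b, hb⟩ := Module.Finite.fg_top (R := MvPolynomial (Fin s) k) (M := F)
  have hmem (y : F) : ∃ m, y ∈ boundedDegreeSpan g b m := by
    have hy : y ∈ Submodule.span (MvPolynomial (Fin s) k) (b : Set F) := hb ▸ Submodule.mem_top
    induction hy using Submodule.span_induction with
    | mem x hx =>
      obtain ⟨m, hm⟩ := exists_mem_restrictDegree (1 : MvPolynomial (Fin s) k)
      refine ⟨m, ?_⟩
      rw [← one_mul x]
      exact Submodule.mul_mem_mul ⟨1, hm, map_one g⟩ (Submodule.subset_span hx)
    | zero => exact ⟨0, zero_mem _⟩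
    | add x y _ _ hx hy =>
      obtain ⟨m, hm⟩ := hx
      obtain ⟨n, hn⟩ := hy
      exact ⟨max m n, add_mem (boundedDegreeSpan_mono g b (le_max_left _ _) hm)
        (boundedDegreeSpan_mono g b (le_max_right _ _) hn)⟩
    | smul a x _ hx =>
      obtain ⟨m, hm⟩ := hx
      obtain ⟨n, hn⟩ := exists_mem_restrictDegree a
      refine ⟨n + m, map_restrictDegree_mul_boundedDegreeSpan_le g b n m ?_⟩
      rw [Algebra.smul_def]
      exact Submodule.mul_mem_mul ⟨a, hn, rfl⟩ hm
  refine ⟨b, fun N hN ↦ ?_⟩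
  obtain ⟨t, rfl⟩ := hN
  choose f hf using hmem
  refine ⟨t.sup f, Submodule.span_le.mpr fun y hy ↦ ?_⟩
  exact boundedDegreeSpan_mono g b (Finset.le_sup hy) (hf y)

lemma exists_finrank_pow_le_of_finite (g : MvPolynomial (Fin s) k →ₐ[k] F) (hg : g.Finite)
    (E : Submodule k F) (hE : E.FG) :
    ∃ C : ℕ, ∀ n : ℕ, Module.finrank k ↥(E ^ n) ≤ C * (n + 1) ^ s := by
  obtain ⟨b, hb⟩ := exists_le_boundedDegreeSpan g hg
  obtain ⟨D, hD⟩ := hb (E * Submodule.span k (b : Set F)) (hE.mul ⟨b, rfl⟩)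
  obtain ⟨D₀, hD₀⟩ := hb 1 (Submodule.one_eq_span (R := k) (A := F) ▸ Submodule.fg_span_singleton 1)
  have hstep (n : ℕ) : E ^ n ≤ boundedDegreeSpan g b (n * D + D₀) := by
    induction n with
    | zero => simpa using hD₀
    | succ n ih =>
      rw [pow_succ']
      refine (mul_le_mul_right ih E).trans ?_
      rw [boundedDegreeSpan, mul_left_comm]
      refine (mul_le_mul_right hD _).trans ?_
      refine (map_restrictDegree_mul_boundedDegreeSpan_le g b _ _).trans_eq ?_
      congr 1
      ring
  refine ⟨(D + D₀ + 1) ^ s * b.card, fun n ↦ ?_⟩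
  obtain ⟨hfin, hle⟩ := finrank_boundedDegreeSpan_le g b (n * D + D₀)
  refine (Submodule.finrank_mono (hstep n)).trans (hle.trans ?_)
  rw [mul_right_comm, ← mul_pow]
  gcongr
  nlinarith [Nat.zero_le (n * D₀)]

end Growth

section Dimension

lemma ringKrullDim_le_of_isIntegral_of_injective {A B : Type*} [CommRing A] [CommRing B]
    [Algebra A B] [Algebra.IsIntegral A B] (h : Function.Injective (algebraMap A B)) :
    ringKrullDim A ≤ ringKrullDim B := by
  refine iSup_le fun l ↦ ?_
  obtain ⟨Q, -, hQ, hQ'⟩ := Ideal.exists_ideal_over_prime_of_isIntegral (S := B)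
    l.head.asIdeal ⊥ (by
      rw [← RingHom.ker_eq_comap_bot, (RingHom.injective_iff_ker_eq_bot _).mp h]
      exact bot_le)
  have : Q.LiesOver l.head.asIdeal := ⟨hQ'.symm⟩
  obtain ⟨L, hL, -⟩ := Ideal.exists_ltSeries_of_hasGoingUp l Q
  rw [← hL]
  exact le_iSup (fun L : LTSeries (PrimeSpectrum B) ↦ (L.length : WithBot ℕ∞)) L

lemma exists_finrank_pow_le {k F : Type*} [Field k] [CommRing F] [Nontrivial F] [Algebra k F]
    [Algebra.FiniteType k F] {d : ℕ} (hd : ringKrullDim F ≤ d)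
    (E : Submodule k F) (hE : E.FG) :
    ∃ C : ℕ, ∀ n : ℕ, Module.finrank k ↥(E ^ n) ≤ C * (n + 1) ^ d := by
  obtain ⟨s, g, hg, hfin⟩ := exists_finite_inj_algHom_of_fg k F
  have hs : s ≤ d := by
    algebraize [g.toRingHom]
    have : Module.Finite (MvPolynomial (Fin s) k) F := hfin
    have := (ringKrullDim_le_of_isIntegral_of_injective (A := MvPolynomial (Fin s) k) (B := F)
      hg).trans hd
    rw [MvPolynomial.ringKrullDim_of_isNoetherianRing, ringKrullDim_eq_zero_of_field] at this
    simpa using this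
  obtain ⟨C, hC⟩ := exists_finrank_pow_le_of_finite g hfin E hE
  exact ⟨C, fun n ↦ (hC n).trans (by gcongr; omega)⟩

end Dimension

lemma exists_sum_finrank_le_of_graded {k S F : Type*} [Field k] [CommRing S] [CommRing F]
    [Nontrivial F] [Algebra S k] [Algebra k F] [Algebra S F] [IsScalarTower S k F]
    [Algebra.FiniteType k F] (hk : Function.Surjective (algebraMap S k)) {d : ℕ}
    (hd : ringKrullDim F ≤ d) (I : Ideal S) [IsNoetherian S I] {Q : ℕ → Type*}
    [∀ j, AddCommGroup (Q j)] [∀ j, Module S (Q j)] [∀ j, Module k (Q j)]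
    [∀ j, IsScalarTower S k (Q j)]
    (μ : ∀ j, ↥(I ^ j) →ₗ[S] F) (hμ_zero : ∀ a, ∃ x : S, μ 0 a = algebraMap S F x)
    (hμ_mul : ∀ i j (a : ↥(I ^ i)) (b : ↥(I ^ j)),
      μ (i + j) ⟨a * b, pow_add I i j ▸ Ideal.mul_mem_mul a.2 b.2⟩ = μ i a * μ j b)
    (c : ∀ j, F →ₗ[S] Q j) (hc : ∀ j (q : Q j), ∃ a, c j (μ j a) = q)
    (hc_ne : ∀ i j, i ≠ j → ∀ a, c i (μ j a) = 0) :
    ∃ C : ℕ, ∀ n : ℕ, ∑ j : Fin (n + 1), Module.finrank k (Q j) ≤ C * (n + 1) ^ d := by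
  classical
  have hfg : (LinearMap.range (μ 1)).FG := by
    have : IsNoetherian S ↥(I ^ 1) := by rwa [pow_one]
    exact Module.Finite.iff_fg.mp inferInstance
  obtain ⟨G, hG⟩ := hfg
  let E : Submodule k F := 1 ⊔ Submodule.span k (LinearMap.range (μ 1))
  have hE : E.FG := by
    refine Submodule.FG.sup ?_ ?_
    · rw [Submodule.one_eq_span]
      exact Submodule.fg_span_singleton 1
    · rw [← hG, Submodule.span_span_of_tower]
      exact Submodule.fg_span G.finite_toSet
  have hmem (j : ℕ) (a : ↥(I ^ j)) : μ j a ∈ E ^ j := by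
    induction j with
    | zero =>
      obtain ⟨x, hx⟩ := hμ_zero a
      rw [hx, IsScalarTower.algebraMap_apply S k F, pow_zero]
      exact Submodule.algebraMap_mem _
    | succ j ih =>
      suffices ∀ x ∈ I ^ j * I ^ 1, ∃ h : x ∈ I ^ (j + 1), μ (j + 1) ⟨x, h⟩ ∈ E ^ (j + 1) from
        (this a (by rw [← pow_add]; exact a.2)).2
      intro x hx
      refine Submodule.mul_induction_on hx (fun x hx y hy ↦ ?_) fun x y ⟨hx, hx'⟩ ⟨hy, hy'⟩ ↦ ?_
      · refine ⟨pow_add I j 1 ▸ Ideal.mul_mem_mul hx hy, ?_⟩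
        rw [hμ_mul j 1 ⟨x, hx⟩ ⟨y, hy⟩, pow_succ]
        exact Submodule.mul_mem_mul (ih _)
          (Submodule.mem_sup_right (Submodule.subset_span ⟨_, rfl⟩))
      · refine ⟨add_mem hx hy, ?_⟩
        have := add_mem hx' hy'
        rwa [← map_add] at this
  obtain ⟨C, hC⟩ := exists_finrank_pow_le hd E hE
  refine ⟨C, fun n ↦ le_trans ?_ (hC n)⟩
  let Φ : F →ₗ[k] (∀ j : Fin (n + 1), Q j) :=
    (LinearMap.pi fun j : Fin (n + 1) ↦ c j).extendScalarsOfSurjective hk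
  have hΦ : Function.Surjective (Φ.domRestrict (E ^ n)) := by
    intro q
    choose a ha using fun j : Fin (n + 1) ↦ hc j (q j)
    refine ⟨⟨∑ j : Fin (n + 1), μ j (a j), Submodule.sum_mem _ fun j _ ↦
      pow_le_pow_right' (show 1 ≤ E from le_sup_left) (Nat.lt_succ_iff.mp j.2) (hmem j _)⟩, ?_⟩
    ext i
    change c i (∑ j : Fin (n + 1), μ j (a j)) = q i
    rw [map_sum, Finset.sum_eq_single i, ha]
    · exact fun j _ hj ↦ hc_ne _ _ (fun h ↦ hj (Fin.ext h.symm)) _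
    · simp
  have := Module.Finite.iff_fg.mpr (hE.pow n)
  have : ∀ j : Fin (n + 1), Module.Finite k (Q j) := fun j ↦
    Module.Finite.of_surjective ((LinearMap.proj j).comp (Φ.domRestrict (E ^ n)))
      ((Function.surjective_eval j).comp hΦ)
  rw [← Module.finrank_pi_fintype]
  exact LinearMap.finrank_le_finrank_of_surjective hΦ

section FiberRing

open IsLocalRing Polynomial

variable {S : Type*} [CommRing S]

/-- The inclusion of the degree `j` part `I ^ j` in the Rees algebra. -/
noncomputable def reesMonomial (I : Ideal S) (j : ℕ) : ↥(I ^ j) →ₗ[S] reesAlgebra I where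
  toFun a := ⟨monomial j a, reesAlgebra.monomial_mem.mpr a.2⟩
  map_add' a b := by ext1; simp
  map_smul' r a := by ext1; simp [smul_monomial]

/-- The projection of the Rees algebra onto its degree `j` part `I ^ j`. -/
def reesCoeff (I : Ideal S) (j : ℕ) : reesAlgebra I →ₗ[S] ↥(I ^ j) where
  toFun f := ⟨(f : S[X]).coeff j, (mem_reesAlgebra_iff I _).mp f.2 j⟩
  map_add' f g := by ext1; simp
  map_smul' r f := by ext1; simp

lemma reesMonomial_mul {I : Ideal S} {i j : ℕ} (a : ↥(I ^ i)) (b : ↥(I ^ j)) :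
    reesMonomial I (i + j) ⟨a * b, pow_add I i j ▸ Ideal.mul_mem_mul a.2 b.2⟩ =
      reesMonomial I i a * reesMonomial I j b := by
  ext1
  simp [reesMonomial, monomial_mul_monomial]

/-- The projection of the fiber ring of `I` along `m` onto its degree `j` part `I ^ j / m I ^ j`. -/
noncomputable def fiberCoeff (I m : Ideal S) (j : ℕ) :
    (reesAlgebra I ⧸ m.map (algebraMap S (reesAlgebra I))) →ₗ[S]
      (↥(I ^ j) ⧸ m • (⊤ : Submodule S ↥(I ^ j))) :=
  (Submodule.mapQ ((m.map (algebraMap S (reesAlgebra I))).restrictScalars S)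
    (m • (⊤ : Submodule S ↥(I ^ j))) (reesCoeff I j) (by
      rw [← Ideal.smul_top_eq_map, ← Submodule.map_le_iff_le_comap, Submodule.map_smul'']
      exact smul_mono_right _ le_top)).comp
  (Submodule.Quotient.restrictScalarsEquiv S
    (m.map (algebraMap S (reesAlgebra I)))).symm.toLinearMap

lemma fiberCoeff_mk (I m : Ideal S) (j : ℕ) (f : reesAlgebra I) :
    fiberCoeff I m j (Ideal.Quotient.mk _ f) = Submodule.Quotient.mk (reesCoeff I j f) :=
  rfl

variable [IsLocalRing S]

lemma nontrivial_fiberRing (I : Ideal S) :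
    Nontrivial (reesAlgebra I ⧸ (maximalIdeal S).map (algebraMap S (reesAlgebra I))) := by
  rw [Ideal.Quotient.nontrivial_iff]
  intro h
  let f : reesAlgebra I →+* S := constantCoeff.comp (reesAlgebra I).val.toRingHom
  have hf : (maximalIdeal S).map (algebraMap S (reesAlgebra I)) ≤ (maximalIdeal S).comap f := by
    rw [Ideal.map_le_iff_le_comap]
    intro x hx
    simpa [f] using hx
  rw [h, top_le_iff, Ideal.comap_eq_top_iff] at hf
  exact (maximalIdeal.isMaximal S).ne_top hf

lemma exists_sum_spanFinrank_pow_le [IsNoetherianRing S] (I : Ideal S) {d : ℕ}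
    (hd : ringKrullDim (reesAlgebra I ⧸
      (maximalIdeal S).map (algebraMap S (reesAlgebra I))) ≤ d) :
    ∃ C : ℕ, ∀ n : ℕ,
      ∑ j : Fin (n + 1), Submodule.spanFinrank (I ^ (j : ℕ)) ≤ C * (n + 1) ^ d := by
  have hspan (j : ℕ) := spanFinrank_eq_finrank_quotient (I ^ j) (IsNoetherian.noetherian _)
  simp_rw [hspan]
  let : Field (S ⧸ maximalIdeal S) := Ideal.Quotient.field _
  let : Algebra (S ⧸ maximalIdeal S)
      (reesAlgebra I ⧸ (maximalIdeal S).map (algebraMap S (reesAlgebra I))) :=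
    Ideal.Quotient.algebraQuotientOfLEComap Ideal.le_comap_map
  have : IsScalarTower S (S ⧸ maximalIdeal S)
      (reesAlgebra I ⧸ (maximalIdeal S).map (algebraMap S (reesAlgebra I))) :=
    .of_algebraMap_eq fun x ↦ rfl
  have := nontrivial_fiberRing I
  have : Algebra.FiniteType S (reesAlgebra I) :=
    (reesAlgebra I).fg_iff_finiteType.mp (reesAlgebra.fg (IsNoetherian.noetherian I))
  have : Algebra.FiniteType (S ⧸ maximalIdeal S)
      (reesAlgebra I ⧸ (maximalIdeal S).map (algebraMap S (reesAlgebra I))) :=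
    .of_restrictScalars_finiteType S (S ⧸ maximalIdeal S) _
  have key := exists_sum_finrank_le_of_graded (k := S ⧸ maximalIdeal S)
    (F := reesAlgebra I ⧸ (maximalIdeal S).map (algebraMap S (reesAlgebra I)))
    (Q := fun j ↦ ↥(I ^ j) ⧸ maximalIdeal S • (⊤ : Submodule S ↥(I ^ j)))
    Ideal.Quotient.mk_surjective hd I
    (fun j ↦ (Ideal.Quotient.mkₐ S _).toLinearMap.comp (reesMonomial I j))
  refine key (fun a ↦ ?_) (fun i j a b ↦ ?_) (fun j ↦ fiberCoeff I (maximalIdeal S) j)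
    (fun j q ↦ ?_) (fun i j hij a ↦ ?_)
  · refine ⟨a, congrArg (Ideal.Quotient.mk _) ?_⟩
    ext1
    rfl
  · exact (congrArg (Ideal.Quotient.mk _) (reesMonomial_mul a b)).trans (map_mul _ _ _)
  · obtain ⟨a, rfl⟩ := Submodule.Quotient.mk_surjective _ q
    refine ⟨a, (fiberCoeff_mk _ _ _ _).trans (congrArg Submodule.Quotient.mk ?_)⟩
    ext1
    simp [reesCoeff, reesMonomial]
  · refine (fiberCoeff_mk _ _ _ _).trans ?_
    rw [show reesCoeff I i (reesMonomial I j a) = 0 by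
      ext1
      simp [reesCoeff, reesMonomial, coeff_monomial, hij.symm], Submodule.Quotient.mk_zero]

end FiberRing

section Estimates

open IsLocalRing

variable {R T : Type*} [CommRing R] [AddCommGroup T] [Module R T]

lemma exists_inf_pow_smul_eq [IsNoetherianRing R] (I : Ideal R) (U : Submodule R T)
    {W : Submodule R T} (hW : W.FG) :
    ∃ c : ℕ, ∀ n ≥ c, U ⊓ I ^ n • W = I ^ (n - c) • (U ⊓ I ^ c • W) := by
  have := Module.Finite.iff_fg.mpr hW
  obtain ⟨c, hc⟩ := I.exists_pow_inf_eq_pow_smul (U.comap W.subtype)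
  have hmap (n : ℕ) : (I ^ n • ⊤ ⊓ U.comap W.subtype).map W.subtype = U ⊓ I ^ n • W := by
    rw [Submodule.map_inf _ W.injective_subtype, Submodule.map_comap_subtype,
      Submodule.map_smul'', Submodule.map_subtype_top, ← inf_assoc,
      inf_eq_left.mpr Submodule.smul_le_right, inf_comm]
  refine ⟨c, fun n hn ↦ ?_⟩
  rw [← hmap, ← hmap, hc n hn, Submodule.map_smul'']

variable [IsNoetherianRing R]

lemma exists_relLength_pow_smul_le [IsLocalRing R] (I : Ideal R) {U W : Submodule R T}
    (hU : U.FG) (hW : W.FG) {d : ℕ} (hd : ringKrullDim (R ⧸ Module.annihilator R U) = d)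
    {N : ℕ} (hfin : ∀ n ≥ N, relLength U (I ^ n • W) ≠ ⊤) :
    ∃ C n₀ : ℕ, ∀ n ≥ n₀, relLength U (I ^ n • W) ≤ C * (n + 1) ^ d := by
  obtain ⟨c₀, hc₀⟩ := exists_inf_pow_smul_eq I U hW
  let P (n : ℕ) := U ⊓ I ^ n • W
  set c := max c₀ N
  have hP (k : ℕ) : P (c + k) = I ^ k • P c := by
    have h : c₀ ≤ c := le_max_left _ _
    change U ⊓ I ^ (c + k) • W = I ^ k • (U ⊓ I ^ c • W)
    rw [hc₀ _ (h.trans (Nat.le_add_right _ _)), hc₀ _ h, ← mul_smul, ← pow_add]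
    congr 2
    omega
  obtain ⟨b, hb⟩ := exists_maximalIdeal_pow_smul_le
    (hfin (c + 1) ((le_max_right _ _).trans (Nat.le_succ c)))
  have hbU : maximalIdeal R ^ b • U ≤ I • P c := by
    rw [← pow_one I, ← hP]
    exact le_inf Submodule.smul_le_right hb
  have hbP (k : ℕ) : maximalIdeal R ^ (b * k) • P c ≤ I ^ k • P c := by
    induction k with
    | zero => simp
    | succ k ih =>
      calc maximalIdeal R ^ (b * (k + 1)) • P c
          = maximalIdeal R ^ b • maximalIdeal R ^ (b * k) • P c := by
            rw [← mul_smul, ← pow_add, mul_add, mul_one, add_comm]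
        _ ≤ maximalIdeal R ^ b • I ^ k • P c := smul_mono_right _ ih
        _ = I ^ k • maximalIdeal R ^ b • P c := smul_comm _ _ _
        _ ≤ I ^ k • I • P c :=
            smul_mono_right _ ((smul_mono_right _ inf_le_left).trans hbU)
        _ = I ^ (k + 1) • P c := by rw [← mul_smul, ← pow_succ]
  obtain ⟨C, hC⟩ := exists_relLength_maximalIdeal_pow_smul_le hU hd
  refine ⟨C * (b + 1) ^ d, c, fun n hn ↦ ?_⟩
  obtain ⟨k, rfl⟩ := Nat.exists_eq_add_of_le hn
  have hle : maximalIdeal R ^ (b * (k + 1)) • U ≤ I ^ (c + k) • W :=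
    calc maximalIdeal R ^ (b * (k + 1)) • U
        = maximalIdeal R ^ (b * k) • maximalIdeal R ^ b • U := by
          rw [← mul_smul, ← pow_add, mul_add, mul_one]
      _ ≤ maximalIdeal R ^ (b * k) • P c :=
          smul_mono_right _ (hbU.trans Submodule.smul_le_right)
      _ ≤ P (c + k) := (hbP k).trans (hP k).ge
      _ ≤ I ^ (c + k) • W := inf_le_right
  refine ((relLength_anti_right U hle).trans (hC _)).trans ?_
  have : C * (b * (k + 1) + 1) ^ d ≤ C * (b + 1) ^ d * (c + k + 1) ^ d := by
    rw [mul_assoc, ← mul_pow]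
    gcongr
    nlinarith
  exact_mod_cast this

lemma relLength_pow_smul_le_spanFinrank (I J K : Ideal R) {V : Submodule R T} (hJV : J • V = ⊥)
    (j : ℕ) :
    relLength (I ^ j • V) (K • I ^ j • V) ≤
      Submodule.spanFinrank (I.map (Ideal.Quotient.mk J) ^ j) * relLength V (K • V) := by
  classical
  obtain ⟨s, hs, hspan⟩ := Submodule.FG.exists_span_finset_card_eq_spanFinrank
    (IsNoetherian.noetherian (I.map (Ideal.Quotient.mk J) ^ j))
  let g := Function.surjInv (Ideal.Quotient.mk_surjective (I := J))
  have hg (x : R ⧸ J) : Ideal.Quotient.mk J (g x) = x := Function.surjInv_eq _ x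
  have hmap : (Ideal.span (s.image g : Set R)).map (Ideal.Quotient.mk J) =
      (I ^ j).map (Ideal.Quotient.mk J) := by
    rw [Ideal.map_span, Finset.coe_image, ← Set.image_comp, Ideal.map_pow, ← hspan]
    simp [hg]
  have hsup : Ideal.span (s.image g : Set R) ⊔ J = I ^ j ⊔ J := by
    have := congrArg (Ideal.comap (Ideal.Quotient.mk J)) hmap
    rwa [Ideal.comap_map_of_surjective' _ Ideal.Quotient.mk_surjective,
      Ideal.comap_map_of_surjective' _ Ideal.Quotient.mk_surjective, Ideal.mk_ker] at this
  have hsmul : Ideal.span (s.image g : Set R) • V = I ^ j • V := by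
    have := congrArg (· • V) hsup
    simpa only [Submodule.sup_smul, hJV, sup_bot_eq] using this
  rw [← hsmul]
  refine (relLength_span_smul_le _ K V).trans ?_
  gcongr
  exact_mod_cast Finset.card_image_le.trans hs.le

end Estimates

section SumGrowth

open Finset Polynomial

/-- The partial sums of `f` are bounded, up to finitely many terms, by a multiple of `n ^ m`. -/
def SumGrowth (f : ℕ → ℕ∞) (m : ℕ) : Prop :=
  ∃ (g : ℕ → ℕ) (C N : ℕ), (∀ n ≥ N, f n ≤ g n) ∧ ∀ n, ∑ j ∈ range (n + 1), g j ≤ C * (n + 1) ^ m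

lemma SumGrowth.add {f f' : ℕ → ℕ∞} {m m' : ℕ} (h : SumGrowth f m) (h' : SumGrowth f' m') :
    SumGrowth (fun n ↦ f n + f' n) (max m m') := by
  obtain ⟨g, C, N, hg, hC⟩ := h
  obtain ⟨g', C', N', hg', hC'⟩ := h'
  refine ⟨fun n ↦ g n + g' n, C + C', max N N', fun n hn ↦ ?_, fun n ↦ ?_⟩
  · push_cast
    exact add_le_add (hg n ((le_max_left _ _).trans hn)) (hg' n ((le_max_right _ _).trans hn))
  · rw [sum_add_distrib, add_mul]
    refine add_le_add ((hC n).trans ?_) ((hC' n).trans ?_) <;> gcongr <;> simp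

lemma SumGrowth.mono {f f' : ℕ → ℕ∞} {m : ℕ} (h : SumGrowth f m) {N : ℕ}
    (hf : ∀ n ≥ N, f' n ≤ f n) : SumGrowth f' m := by
  obtain ⟨g, C, N', hg, hC⟩ := h
  exact ⟨g, C, max N N', fun n hn ↦ (hf n ((le_max_left _ _).trans hn)).trans
    (hg n ((le_max_right _ _).trans hn)), hC⟩

lemma SumGrowth.of_eq_zero {f : ℕ → ℕ∞} {N : ℕ} (h : ∀ n ≥ N, f n = 0) : SumGrowth f 0 :=
  ⟨0, 0, N, fun n hn ↦ by simp [h n hn], by simp⟩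

lemma SumGrowth.of_le_pow {f : ℕ → ℕ∞} {C N d : ℕ} (h : ∀ n ≥ N, f n ≤ C * (n + 1) ^ d) :
    SumGrowth f (d + 1) := by
  refine ⟨fun n ↦ C * (n + 1) ^ d, C, N, fun n hn ↦ by exact_mod_cast h n hn, fun n ↦ ?_⟩
  calc ∑ j ∈ range (n + 1), C * (j + 1) ^ d
      ≤ ∑ j ∈ range (n + 1), C * (n + 1) ^ d := by
        refine sum_le_sum fun j hj ↦ ?_
        have : j ≤ n := by simpa [Nat.lt_succ_iff] using hj
        gcongr
    _ = C * (n + 1) ^ (d + 1) := by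
        rw [sum_const, card_range, smul_eq_mul]
        ring

lemma SumGrowth.natDegree_lt {f : ℕ → ℕ∞} {m : ℕ} (h : SumGrowth f m) {p : ℚ[X]} (hp : p ≠ 0)
    {N : ℕ} (hf : ∀ n ≥ N, ∃ l : ℕ, f n = l ∧ (l : ℚ) = p.eval (n : ℚ)) :
    p.natDegree + 1 ≤ m := by
  obtain ⟨g, C, N', hg, hC⟩ := h
  set e := p.natDegree
  have hO : (fun x : ℚ ↦ eval x (X ^ e : ℚ[X])) =O[Filter.atTop] fun x ↦ eval x p := by
    refine isBigO_atTop_of_degree_le _ _ ?_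
    rw [degree_X_pow, degree_eq_natDegree hp]
  obtain ⟨c, hc, hO⟩ := (hO.comp_tendsto (tendsto_natCast_atTop_atTop (R := ℚ))).exists_pos
  obtain ⟨N₁, hN₁⟩ := Filter.eventually_atTop.mp hO.bound
  have hle (n : ℕ) (hn : n ≥ max N₁ (max N N')) : (n : ℝ) ^ e ≤ c * g n := by
    simp only [ge_iff_le, max_le_iff] at hn
    obtain ⟨l, hl, hlp⟩ := hf n hn.2.1
    have h1 := hN₁ n hn.1
    have h2 : l ≤ g n := by exact_mod_cast hl ▸ hg n hn.2.2
    simp only [Function.comp_apply, eval_pow, eval_X, ← hlp, norm_pow] at h1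
    simp only [← Rat.norm_cast_real, Rat.cast_natCast, Real.norm_natCast] at h1
    exact h1.trans (by gcongr)
  by_contra! hm
  have hme : m ≤ e := by omega
  have key (n : ℕ) (hn : n ≥ max N₁ (max N N')) (hn0 : 1 ≤ n) :
      (n : ℝ) ≤ c * (C * 2 ^ m) := by
    have hn0' : (1 : ℝ) ≤ n := by exact_mod_cast hn0
    have h1 : (n : ℝ) * n ^ e ≤ c * (C * 2 ^ m) * n ^ e :=
      calc (n : ℝ) * n ^ e = ∑ j ∈ Ico n (2 * n), (n : ℝ) ^ e := by
            rw [sum_const, Nat.card_Ico, nsmul_eq_mul]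
            congr 2
            omega
        _ ≤ ∑ j ∈ Ico n (2 * n), c * g j := by
            refine sum_le_sum fun j hj ↦ ?_
            rw [mem_Ico] at hj
            refine le_trans ?_ (hle j (hn.trans hj.1))
            have : (n : ℝ) ≤ j := by exact_mod_cast hj.1
            gcongr
        _ ≤ ∑ j ∈ range (2 * n), c * g j := by
            refine sum_le_sum_of_subset_of_nonneg (fun j hj ↦ ?_) fun j _ _ ↦ by positivity
            simp only [mem_Ico, mem_range] at hj ⊢
            exact hj.2
        _ = c * ((∑ j ∈ range (2 * n - 1 + 1), g j : ℕ) : ℝ) := by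
            rw [Nat.sub_add_cancel (by omega), ← mul_sum]
            push_cast
            rfl
        _ ≤ c * ((C * (2 * n - 1 + 1) ^ m : ℕ) : ℝ) := by
            gcongr
            exact hC _
        _ = c * (C * 2 ^ m) * n ^ m := by
            rw [Nat.sub_add_cancel (by omega)]
            push_cast
            ring
        _ ≤ c * (C * 2 ^ m) * n ^ e := by gcongr
    exact le_of_mul_le_mul_right h1 (by positivity)
  obtain ⟨n, hn⟩ := exists_nat_gt (c * (C * 2 ^ m))
  have := key (max n (max 1 (max N₁ (max N N')))) (by simp) (by simp)
  have h2 : (n : ℝ) ≤ (max n (max 1 (max N₁ (max N N'))) : ℕ) := by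
    exact_mod_cast le_max_left _ _
  linarith

end SumGrowth

section Degree

open IsLocalRing

variable {R T : Type*} [CommRing R] [AddCommGroup T] [Module R T]

lemma moduleLength_eq_relLength (A B : Submodule R T) :
    moduleLength R ↥(A.map B.mkQ) = (relLength A B : WithBot ℕ∞) :=
  (Module.coe_length R _).symm

lemma isFiniteLength_iff_relLength_ne_top (A B : Submodule R T) :
    IsFiniteLength R ↥(A.map B.mkQ) ↔ relLength A B ≠ ⊤ :=
  Module.length_ne_top_iff.symm

variable [IsNoetherianRing R] [IsLocalRing R]

lemma exists_sumGrowth_relLength_pow_smul (I : Ideal R) {U W : Submodule R T}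
    (hU : U.FG) (hW : W.FG) {N : ℕ} (hfin : ∀ n ≥ N, relLength U (I ^ n • W) ≠ ⊤)
    (hdim : ringKrullDim (R ⧸ Module.annihilator R U) ≠ ⊤) :
    ∃ m, SumGrowth (fun n ↦ relLength U (I ^ n • W)) m ∧
      ∀ e : ℕ, e + 1 ≤ m → (e : WithBot ℕ∞) ≤ ringKrullDim (R ⧸ Module.annihilator R U) := by
  rcases hd : ringKrullDim (R ⧸ Module.annihilator R U) with _ | _ | d
  · refine ⟨0, .of_eq_zero (N := 0) fun n _ ↦ relLength_eq_zero ?_, by simp⟩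
    have := Order.krullDim_eq_bot_iff.mp hd
    rw [PrimeSpectrum.isEmpty_iff_subsingleton, Ideal.Quotient.subsingleton_iff,
      Module.annihilator_eq_top_iff, Submodule.subsingleton_iff_eq_bot] at this
    exact this ▸ bot_le
  · exact absurd hd hdim
  · obtain ⟨C, N, h⟩ := exists_relLength_pow_smul_le I hU hW hd hfin
    exact ⟨d + 1, .of_le_pow h, fun e he ↦ Nat.cast_le.mpr (Nat.le_of_succ_le_succ he)⟩

lemma exists_sumGrowth_relLength_sup (I J : Ideal R) {U V W : Submodule R T} (hV : V.FG)
    (hJV : J • V = ⊥) {N : ℕ} (hfin : relLength (I ^ N • V) (I ^ N • W) ≠ ⊤)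
    (hspread : analyticSpread (I.map (Ideal.Quotient.mk J))
      ((maximalIdeal R).map (Ideal.Quotient.mk J)) ≠ ⊤) :
    ∃ m, SumGrowth (fun n ↦ relLength (I ^ n • V) (U ⊔ I ^ n • W)) m ∧
      ∀ e : ℕ, e + 1 ≤ m → (e + 1 : WithBot ℕ∞) ≤ analyticSpread (I.map (Ideal.Quotient.mk J))
        ((maximalIdeal R).map (Ideal.Quotient.mk J)) := by
  rcases eq_or_ne J ⊤ with rfl | hJ
  · rw [Submodule.top_smul] at hJV
    refine ⟨0, .of_eq_zero (N := 0) fun n _ ↦ relLength_eq_zero ?_, by simp⟩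
    simp [hJV]
  have : Nontrivial (R ⧸ J) := Ideal.Quotient.nontrivial_iff.mpr hJ
  have : IsLocalRing (R ⧸ J) := .of_surjective' _ Ideal.Quotient.mk_surjective
  have hmax : (maximalIdeal R).map (Ideal.Quotient.mk J) = maximalIdeal (R ⧸ J) :=
    map_maximalIdeal_of_surjective _ Ideal.Quotient.mk_surjective
  rw [hmax] at hspread ⊢
  obtain ⟨d, hd⟩ : ∃ d : ℕ, analyticSpread (I.map (Ideal.Quotient.mk J))
      (maximalIdeal (R ⧸ J)) = d := by
    have := nontrivial_fiberRing (I.map (Ideal.Quotient.mk J))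
    rcases hd : analyticSpread (I.map (Ideal.Quotient.mk J))
      (maximalIdeal (R ⧸ J)) with _ | _ | d
    · exact absurd hd (Order.krullDim_ne_bot_iff.mpr inferInstance)
    · exact absurd hd hspread
    · exact ⟨d, rfl⟩
  obtain ⟨C, hC⟩ := exists_sum_spanFinrank_pow_le _ hd.le
  obtain ⟨k, hk⟩ := exists_maximalIdeal_pow_smul_le hfin
  have hk' (n : ℕ) (hn : n ≥ N) : maximalIdeal R ^ k • I ^ n • V ≤ U ⊔ I ^ n • W := by
    obtain ⟨j, rfl⟩ := Nat.exists_eq_add_of_le hn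
    rw [add_comm, pow_add, mul_smul, mul_smul, smul_comm]
    exact (smul_mono_right _ hk).trans le_sup_right
  refine ⟨d, ⟨fun j ↦ Submodule.spanFinrank (I.map (Ideal.Quotient.mk J) ^ j) *
    (relLength V (maximalIdeal R ^ k • V)).toNat,
    C * (relLength V (maximalIdeal R ^ k • V)).toNat, N, fun n hn ↦ ?_, fun n ↦ ?_⟩,
    fun e he ↦ ?_⟩
  · refine (relLength_anti_right _ (hk' n hn)).trans
      ((relLength_pow_smul_le_spanFinrank I J _ hJV n).trans ?_)
    push_cast
    rw [ENat.natCast_toNat (relLength_maximalIdeal_pow_smul_ne_top hV k)]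
  · rw [← Finset.sum_mul, mul_right_comm, Finset.sum_range]
    exact Nat.mul_le_mul_right _ (hC n)
  · rw [hd]
    exact_mod_cast he

lemma exists_sumGrowth_relLength (I J : Ideal R) {U V W : Submodule R T} (hU : U.FG) (hV : V.FG)
    (hW : W.FG) (hJV : J • V = ⊥) {N : ℕ}
    (hfin : ∀ n ≥ N, relLength (U ⊔ I ^ n • V) (I ^ n • W) ≠ ⊤)
    (hdim : ringKrullDim (R ⧸ Module.annihilator R U) ≠ ⊤)
    (hspread : analyticSpread (I.map (Ideal.Quotient.mk J))
      ((maximalIdeal R).map (Ideal.Quotient.mk J)) ≠ ⊤) :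
    ∃ m, SumGrowth (fun n ↦ relLength (U ⊔ I ^ n • V) (I ^ n • W)) m ∧
      ∀ e : ℕ, e + 1 ≤ m →
        (e : WithBot ℕ∞) ≤ ringKrullDim (R ⧸ Module.annihilator R U) ∨
        (e + 1 : WithBot ℕ∞) ≤ analyticSpread (I.map (Ideal.Quotient.mk J))
          ((maximalIdeal R).map (Ideal.Quotient.mk J)) := by
  obtain ⟨m, hm, hm'⟩ := exists_sumGrowth_relLength_pow_smul I hU hW
    (fun n hn ↦ ne_top_of_le_ne_top (hfin n hn) (relLength_mono_left le_sup_left _)) hdim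
  obtain ⟨l, hl, hl'⟩ := exists_sumGrowth_relLength_sup (U := U) I J hV hJV
    (ne_top_of_le_ne_top (hfin N le_rfl) (relLength_mono_left le_sup_right _)) hspread
  refine ⟨max l m, (hl.add hm).mono (N := 0) fun n _ ↦ ?_, fun e he ↦ ?_⟩
  · refine (relLength_le_add _ (U ⊔ I ^ n • W) _).trans (add_le_add ?_ ?_)
    · rw [sup_comm, relLength_sup_left_of_le le_sup_left]
    · rw [relLength_sup_left_of_le le_rfl]
  · rcases le_max_iff.mp he with h | h
    · exact .inr (hl' e h)
    · exact .inl (hm' e h)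

end Degree

/-- Lemma 2(c). Let `(R, m)` be a commutative Noetherian local ring, `I` an
ideal, `T` an `R`-module, `U, V, W, Z` finitely generated submodules of `T` with `Z ⊆ U`,
`W ⊆ V`.  Set `Lₙ := (U + IⁿV)/(Z + IⁿW)`, assume `Lₙ` has finite length for `n ≫ 0`, and let
`J ⊆ ann_R((V + Z)/Z)` be an ideal.  Then any polynomial `p ∈ ℚ[X]` with `λ(Lₙ) = p(n)` for
all `n ≫ 0` satisfies `deg p ≤ max {dim U/Z, ℓ_{R/J}(I) - 1}`; the inequality
`deg p ≤ ℓ_{R/J}(I) - 1` is encoded as `deg p + 1 ≤ ℓ_{R/J}(I)`. -/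
theorem stmt_4 {R : Type*} [CommRing R] [IsNoetherianRing R] [IsLocalRing R] (I J : Ideal R)
    {T : Type*} [AddCommGroup T] [Module R T]
    (U V W Z : Submodule R T) (hU : U.FG) (hV : V.FG) (hW : W.FG) (hZ : Z.FG)
    (hZU : Z ≤ U) (hWV : W ≤ V)
    (hJ : J ≤ Module.annihilator R ↥((V ⊔ Z).map Z.mkQ))
    (hfin : ∃ N : ℕ, ∀ n ≥ N,
      IsFiniteLength R ↥((U ⊔ I ^ n • V).map (Z ⊔ I ^ n • W).mkQ)) :
    ∀ p : Polynomial ℚ,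
      (∃ N : ℕ, ∀ n ≥ N, ∃ ℓ : ℕ,
        moduleLength R ↥((U ⊔ I ^ n • V).map (Z ⊔ I ^ n • W).mkQ) = ℓ ∧
        (ℓ : ℚ) = p.eval (n : ℚ)) →
      (polyDeg p ≤ ringKrullDim (R ⧸ Module.annihilator R ↥(U.map Z.mkQ)) ∨
        polyDeg p + 1 ≤ analyticSpread (I.map (Ideal.Quotient.mk J))
          ((IsLocalRing.maximalIdeal R).map (Ideal.Quotient.mk J))) := by
  rintro p ⟨N₁, hp⟩
  obtain ⟨N, hfin⟩ := hfin
  rcases eq_or_ne p 0 with rfl | hp0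
  · left
    simp [polyDeg]
  have hL (n : ℕ) : relLength (U ⊔ I ^ n • V) (Z ⊔ I ^ n • W) =
      relLength (U.map Z.mkQ ⊔ I ^ n • V.map Z.mkQ) (I ^ n • W.map Z.mkQ) := by
    rw [← relLength_map_of_ker_le Z.mkQ (by rw [Submodule.ker_mkQ]; exact le_sup_left),
      Submodule.map_sup, Submodule.map_sup, Submodule.map_smul'', Submodule.map_smul'',
      Submodule.mkQ_map_self, bot_sup_eq]
  have hZ0 : (V ⊔ Z).map Z.mkQ = V.map Z.mkQ := by
    rw [Submodule.map_sup, Submodule.mkQ_map_self, sup_bot_eq]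
  rw [hZ0] at hJ
  have hJV : J • V.map Z.mkQ = ⊥ := by
    rw [eq_bot_iff, Submodule.smul_le]
    intro r hr x hx
    exact congrArg Subtype.val (Module.mem_annihilator.mp (hJ hr) ⟨x, hx⟩)
  by_cases hdim : ringKrullDim (R ⧸ Module.annihilator R ↥(U.map Z.mkQ)) = ⊤
  · exact .inl (hdim ▸ le_top)
  by_cases hspread : analyticSpread (I.map (Ideal.Quotient.mk J))
      ((IsLocalRing.maximalIdeal R).map (Ideal.Quotient.mk J)) = ⊤
  · exact .inr (hspread ▸ le_top)
  have hdeg : polyDeg p = (p.natDegree : WithBot ℕ∞) := by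
    rw [polyDeg, Polynomial.degree_eq_natDegree hp0]
    rfl
  rw [hdeg]
  obtain ⟨m, hm, hm'⟩ := exists_sumGrowth_relLength I J (hU.map Z.mkQ) (hV.map Z.mkQ)
    (hW.map Z.mkQ) hJV (fun n hn ↦ by
      rw [← hL, ← isFiniteLength_iff_relLength_ne_top]
      exact hfin n hn) hdim hspread
  refine hm' _ (hm.natDegree_lt hp0 (N := N₁) fun n hn ↦ ?_)
  obtain ⟨l, hl, hlp⟩ := hp n hn
  refine ⟨l, ?_, hlp⟩
  rw [moduleLength_eq_relLength, hL] at hl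
  exact_mod_cast hl
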